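/- Let R be a commutative ring and let N : I³ → Ch(R) be a 3-cube of cochain complexes of R-modules with vertices N_{abc} (a,b,c ∈ {0,1}) and edge maps ζ : N₀₀₀ → N₀₀₁, η : N₀₀₀ → N₁₀₀, ν : N₀₀₀ → N₀₁₀, β : N₀₀₁ → N₁₀₁, α : N₀₀₁ → N₀₁₁, ε : N₁₀₀ → N₁₀₁, μ : N₁₀₀ → N₁₁₀, κ : N₀₁₀ → N₀₁₁, λ : N₀₁₀ → N₁₁₀, γ : N₁₀₁ → N₁₁₁, δ : N₀₁₁ → N₁₁₁, π : N₁₁₀ → N₁₁₁ (all faces commuting). Assume: (1) there exists a chain map s : N₁₁₁ → N₁₀₁ with γ∘s = id and such that β ⊕ s : N₀₀₁ ⊕ N₁₁₁ → N₁₀₁ is a quasi-isomorphism; (2) there exists a chain map t : N₁₀₀ → N₀₀₁ with β∘t = ε and t∘η = ζ. Then C₃N is quasi-isomorphic to (C₂M)⟦1⟧, where M is the commutative square of cochain complexes with corners M₀₀ = N₀₀₀, M₁₀ = N₁₀₀, M₀₁ = N₀₁₀, M₁₁ = N₁₁₀ ⊕ N₀₁₁, left map η : N₀₀₀ → N₁₀₀,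 bottom map ν : N₀₀₀ → N₀₁₀, top map (μ, α∘t) : N₁₀₀ → N₁₁₀ ⊕ N₀₁₁, and right map (λ, κ) : N₀₁₀ → N₁₁₀ ⊕ N₀₁₁. (This is the chain-complex analogue of the paper's Lemma 6.2, stated there for diagrams of symmetric spectra.) -/

import Mathlib

open CategoryTheory CategoryTheory.Limits CochainComplex

/-- The category `Ch(R)` of cochain complexes of `R`-modules. -/
abbrev Ch (R : Type) [CommRing R] := CochainComplex (ModuleCat R) ℤ

/-- The total cofiber `C₂M` of a commutative square `M` of cochain complexes, with `β, γ`
the maps in the first coordinate and `α, δ` the maps in the second coordinate: the mapping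
cone of the induced map `cone(β) → cone(δ)`. -/
noncomputable def totalCofiberSq {R : Type} [CommRing R] {M₀₀ M₁₀ M₀₁ M₁₁ : Ch R}
    (α : M₀₀ ⟶ M₀₁) (β : M₀₀ ⟶ M₁₀) (γ : M₁₀ ⟶ M₁₁) (δ : M₀₁ ⟶ M₁₁)
    (comm : β ≫ γ = α ≫ δ) : Ch R :=
  mappingCone (mappingCone.map β δ α γ comm)

/-- Auxiliary congruence lemma for `mappingCone.map`. -/
lemma mappingConeMapCongr {R : Type} [CommRing R] {K₁ L₁ K₂ L₂ : Ch R}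
    (φ₁ : K₁ ⟶ L₁) (φ₂ : K₂ ⟶ L₂) {a a' : K₁ ⟶ K₂} {b b' : L₁ ⟶ L₂}
    (ha : a = a') (hb : b = b') (comm : φ₁ ≫ b = a ≫ φ₂) (comm' : φ₁ ≫ b' = a' ≫ φ₂) :
    mappingCone.map φ₁ φ₂ a b comm = mappingCone.map φ₁ φ₂ a' b' comm' := by
  subst ha; subst hb; rfl

/-- The total cofiber `C₃N` of a commutative 3-cube `N` of cochain complexes (indices:
first, second, third coordinate; `ζ, η, ν` are the edges out of `N₀₀₀` in the third, first
and second coordinate direction respectively): the mapping cone of the induced map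
`C₂(N_{··0}) → C₂(N_{··1})` between the total cofibers of the two faces with constant
third coordinate. -/
noncomputable def totalCofiberCube {R : Type} [CommRing R]
    {N₀₀₀ N₀₀₁ N₀₁₀ N₀₁₁ N₁₀₀ N₁₀₁ N₁₁₀ N₁₁₁ : Ch R}
    (ζ : N₀₀₀ ⟶ N₀₀₁) (η : N₀₀₀ ⟶ N₁₀₀) (ν : N₀₀₀ ⟶ N₀₁₀)
    (β : N₀₀₁ ⟶ N₁₀₁) (α : N₀₀₁ ⟶ N₀₁₁) (ε : N₁₀₀ ⟶ N₁₀₁) (μ : N₁₀₀ ⟶ N₁₁₀)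
    (κ : N₀₁₀ ⟶ N₀₁₁) (lam : N₀₁₀ ⟶ N₁₁₀)
    (γ : N₁₀₁ ⟶ N₁₁₁) (δ : N₀₁₁ ⟶ N₁₁₁) (π : N₁₁₀ ⟶ N₁₁₁)
    (face₁ : η ≫ μ = ν ≫ lam) (face₂ : β ≫ γ = α ≫ δ)
    (face₃ : η ≫ ε = ζ ≫ β) (face₄ : lam ≫ π = κ ≫ δ)
    (face₅ : ζ ≫ α = ν ≫ κ) (face₆ : ε ≫ γ = μ ≫ π) : Ch R :=
  mappingCone (mappingCone.map
    (mappingCone.map η lam ν μ face₁)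
    (mappingCone.map β δ α γ face₂)
    (mappingCone.map η β ζ ε face₃)
    (mappingCone.map lam δ κ π face₄)
    (by
      rw [← mappingCone.map_comp _ _ _ _ _ face₁ _ _ face₄,
        ← mappingCone.map_comp _ _ _ _ _ face₃ _ _ face₂]
      exact mappingConeMapCongr _ _ face₅.symm face₆.symm _ _))

namespace TotalCofiber

open HomComplex

universe v

lemma quasiIso_mappingCone_map {C : Type*} [Category* C] [Abelian C]
    {K₁ L₁ K₂ L₂ : CochainComplex C ℤ} (φ₁ : K₁ ⟶ L₁) (φ₂ : K₂ ⟶ L₂) (a : K₁ ⟶ K₂) (b : L₁ ⟶ L₂)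
    (comm : φ₁ ≫ b = a ≫ φ₂) (ha : QuasiIso a) (hb : QuasiIso b) :
    QuasiIso (mappingCone.map φ₁ φ₂ a b comm) := by
  let _ := HasDerivedCategory.standard C
  rw [← DerivedCategory.isIso_Q_map_iff_quasiIso] at ha hb ⊢
  exact Pretriangulated.isIso₃_of_isIso₁₂
    (DerivedCategory.Q.mapTriangle.map (mappingCone.triangleMap φ₁ φ₂ a b comm))
    ((DerivedCategory.mem_distTriang_iff _).2 ⟨_, _, φ₁, ⟨Iso.refl _⟩⟩)
    ((DerivedCategory.mem_distTriang_iff _).2 ⟨_, _, φ₂, ⟨Iso.refl _⟩⟩) ha hb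

lemma exists_quasiIso_shift {C : Type*} [Category* C] [Abelian C]
    {K B : CochainComplex C ℤ} (F : Cochain K B (-1)) (hF : δ (-1) 0 F = 0)
    (p : Cochain B K 1) (h : Cochain B B (-1))
    (hFp : F.comp p (neg_add_cancel 1) = Cochain.ofHom (𝟙 K))
    (hpF : p.comp F (add_neg_cancel 1) + δ (-1) 0 h = Cochain.ofHom (𝟙 B)) :
    ∃ φ : K⟦(1 : ℤ)⟧ ⟶ B, QuasiIso φ := by
  have hp : δ 1 2 p = 0 := by
    have h₁ : (δ 1 2 p).comp F (show 2 + -1 = 1 by lia) = 0 := by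
      have := congrArg (δ 0 1) hpF
      rw [δ_add, δ_δ, δ_comp p F _ 2 0 1 (by lia) (by lia) (by lia), hF] at this
      simpa using this
    have h₂ := congrArg (fun z ↦ z.comp p (show 1 + 1 = 2 by lia)) h₁
    simp only [Cochain.zero_comp] at h₂
    rw [Cochain.comp_assoc _ _ _ _ (neg_add_cancel 1) (by lia), hFp, Cochain.comp_id] at h₂
    exact h₂
  let φ : K⟦(1 : ℤ)⟧ ⟶ B :=
    Cocycle.homOf ((Cocycle.mk F 0 (by lia) hF).leftShift 1 0 (by lia))
  let ψ : B ⟶ K⟦(1 : ℤ)⟧ :=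
    Cocycle.homOf ((Cocycle.mk p 2 (by lia) hp).rightShift 1 0 (by lia))
  have hφ (n : ℤ) : φ.f n = F.v (n + 1) n (by lia) := by
    simp [φ, Cochain.leftShift_v F 1 0 (by lia) n n _ (n + 1) (by lia), shiftFunctorObjXIso]
    exact Category.id_comp _
  have hψ (n : ℤ) : ψ.f n = p.v n (n + 1) rfl := by
    simp [ψ, Cochain.rightShift_v p 1 0 (by lia) n n _ (n + 1) (by lia), shiftFunctorObjXIso]
    exact Category.comp_id _
  have hφψ : φ ≫ ψ = 𝟙 _ := by
    ext n
    have := Cochain.congr_v hFp (n + 1) (n + 1) (by lia)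
    rw [Cochain.comp_v _ _ _ (n + 1) n (n + 1) (by lia) (by lia)] at this
    rw [HomologicalComplex.comp_f, hφ, hψ]
    exact this.trans (by simp)
  have hψφ : Cochain.ofHom (ψ ≫ φ) = p.comp F (add_neg_cancel 1) := by
    ext n
    rw [Cochain.comp_v _ _ _ n (n + 1) n (by lia) (by lia), Cochain.ofHom_v,
      HomologicalComplex.comp_f, hφ, hψ]
    rfl
  let e : HomotopyEquiv (K⟦(1 : ℤ)⟧) B :=
    { hom := φ
      inv := ψ
      homotopyHomInvId := Homotopy.ofEq hφψ
      homotopyInvHomId := (Cochain.equivHomotopy _ _).symm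
        ⟨-h, by rw [hψφ, ← hpF, δ_neg]; abel⟩ }
  exact ⟨φ, e.quasiIso_hom⟩

variable {R : Type} [CommRing R]

section Square

variable {M₀₀ M₁₀ M₀₁ M₁₁ : Ch R}
  (a : M₀₀ ⟶ M₀₁) (b : M₀₀ ⟶ M₁₀) (c : M₁₀ ⟶ M₁₁) (d : M₀₁ ⟶ M₁₁) (comm : b ≫ c = a ≫ d)

/-- The inclusion of the vertex `M₀₀` in the total cofiber of a square. -/
noncomputable def ι₀₀ : Cochain M₀₀ (mappingCone (mappingCone.map b d a c comm)) (-2) :=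
  (mappingCone.inl b).comp (mappingCone.inl (mappingCone.map b d a c comm)) (by lia)

/-- The inclusion of the vertex `M₁₀` in the total cofiber of a square. -/
noncomputable def ι₁₀ : Cochain M₁₀ (mappingCone (mappingCone.map b d a c comm)) (-1) :=
  (Cochain.ofHom (mappingCone.inr b)).comp
    (mappingCone.inl (mappingCone.map b d a c comm)) (zero_add _)

/-- The inclusion of the vertex `M₀₁` in the total cofiber of a square. -/
noncomputable def ι₀₁ : Cochain M₀₁ (mappingCone (mappingCone.map b d a c comm)) (-1) :=
  (mappingCone.inl d).comp
    (Cochain.ofHom (mappingCone.inr (mappingCone.map b d a c comm))) (add_zero _)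

/-- The inclusion of the vertex `M₁₁` in the total cofiber of a square. -/
noncomputable def ι₁₁ : Cochain M₁₁ (mappingCone (mappingCone.map b d a c comm)) 0 :=
  Cochain.ofHom (mappingCone.inr d ≫ mappingCone.inr (mappingCone.map b d a c comm))

lemma inl_comp_ofHom_map {K₁ L₁ K₂ L₂ : Ch R} (φ₁ : K₁ ⟶ L₁) (φ₂ : K₂ ⟶ L₂) (u : K₁ ⟶ K₂)
    (v : L₁ ⟶ L₂) (h : φ₁ ≫ v = u ≫ φ₂) :
    (mappingCone.inl φ₁).comp (Cochain.ofHom (mappingCone.map φ₁ φ₂ u v h)) (add_zero _) =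
      (Cochain.ofHom u).comp (mappingCone.inl φ₂) (zero_add _) := by
  simp [mappingCone.map]

lemma inr_comp_map {K₁ L₁ K₂ L₂ : Ch R} (φ₁ : K₁ ⟶ L₁) (φ₂ : K₂ ⟶ L₂) (u : K₁ ⟶ K₂)
    (v : L₁ ⟶ L₂) (h : φ₁ ≫ v = u ≫ φ₂) :
    mappingCone.inr φ₁ ≫ mappingCone.map φ₁ φ₂ u v h = v ≫ mappingCone.inr φ₂ := by
  simp [mappingCone.map]

lemma δ_ι₀₀ : δ (-2) (-1) (ι₀₀ a b c d comm) =
    (Cochain.ofHom a).comp (ι₀₁ a b c d comm) (zero_add _) -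
      (Cochain.ofHom b).comp (ι₁₀ a b c d comm) (zero_add _) := by
  rw [ι₀₀, δ_comp _ _ _ 0 0 (-1) (by lia) (by lia) (by lia), mappingCone.δ_inl,
    mappingCone.δ_inl, Cochain.ofHom_comp, Cochain.ofHom_comp,
    ← Cochain.comp_assoc_of_second_is_zero_cochain, inl_comp_ofHom_map, ι₀₁, ι₁₀]
  simp [sub_eq_add_neg]

lemma δ_ι₁₀ : δ (-1) 0 (ι₁₀ a b c d comm) =
    (Cochain.ofHom c).comp (ι₁₁ a b c d comm) (zero_add _) := by
  rw [ι₁₀, δ_ofHom_comp, mappingCone.δ_inl, ← Cochain.ofHom_comp, ← Category.assoc,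
    inr_comp_map, ι₁₁, Category.assoc, ← Cochain.ofHom_comp]

lemma δ_ι₀₁ : δ (-1) 0 (ι₀₁ a b c d comm) =
    (Cochain.ofHom d).comp (ι₁₁ a b c d comm) (zero_add _) := by
  rw [ι₀₁, δ_comp_ofHom, mappingCone.δ_inl, ← Cochain.ofHom_comp, ι₁₁, ← Cochain.ofHom_comp,
    Category.assoc]

lemma δ_ι₁₁ : δ 0 1 (ι₁₁ a b c d comm) = 0 := by
  rw [ι₁₁, δ_ofHom]

/-- The cochain from the total cofiber of a square given by cochains from its vertices. -/
noncomputable def descSq {L : Ch R} {n₂ n₁ n : ℤ} (x₀₀ : Cochain M₀₀ L n₂)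
    (x₁₀ : Cochain M₁₀ L n₁) (x₀₁ : Cochain M₀₁ L n₁) (x₁₁ : Cochain M₁₁ L n)
    (h₁ : n₂ + 1 = n₁) (h₂ : n₁ + 1 = n) : Cochain (mappingCone (mappingCone.map b d a c comm)) L n :=
  mappingCone.descCochain _ (mappingCone.descCochain b x₀₀ x₁₀ h₁)
    (mappingCone.descCochain d x₀₁ x₁₁ h₂) h₂

section

variable {L : Ch R} {n₂ n₁ n : ℤ} (x₀₀ : Cochain M₀₀ L n₂)
    (x₁₀ : Cochain M₁₀ L n₁) (x₀₁ : Cochain M₀₁ L n₁) (x₁₁ : Cochain M₁₁ L n)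
    (h₁ : n₂ + 1 = n₁) (h₂ : n₁ + 1 = n)

@[simp]
lemma ι₀₀_descSq (h : -2 + n = n₂) :
    (ι₀₀ a b c d comm).comp (descSq a b c d comm x₀₀ x₁₀ x₀₁ x₁₁ h₁ h₂) h = x₀₀ := by
  rw [ι₀₀, descSq, Cochain.comp_assoc _ _ _ _ (show -1 + n = n₁ by lia) (by lia),
    mappingCone.inl_descCochain, mappingCone.inl_descCochain]

@[simp]
lemma ι₁₀_descSq (h : -1 + n = n₁) :
    (ι₁₀ a b c d comm).comp (descSq a b c d comm x₀₀ x₁₀ x₀₁ x₁₁ h₁ h₂) h = x₁₀ := by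
  rw [ι₁₀, descSq, Cochain.comp_assoc _ _ _ _ h (by lia),
    mappingCone.inl_descCochain, mappingCone.inr_descCochain]

@[simp]
lemma ι₀₁_descSq (h : -1 + n = n₁) :
    (ι₀₁ a b c d comm).comp (descSq a b c d comm x₀₀ x₁₀ x₀₁ x₁₁ h₁ h₂) h = x₀₁ := by
  rw [ι₀₁, descSq, Cochain.comp_assoc _ _ _ _ (zero_add n) (by lia),
    mappingCone.inr_descCochain, mappingCone.inl_descCochain]

@[simp]
lemma ι₁₁_descSq :
    (ι₁₁ a b c d comm).comp
      (descSq a b c d comm x₀₀ x₁₀ x₀₁ x₁₁ h₁ h₂) (zero_add n) = x₁₁ := by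
  rw [ι₁₁, descSq, Cochain.ofHom_comp, Cochain.comp_assoc _ _ _ _ (zero_add n) (by lia),
    mappingCone.inr_descCochain, mappingCone.inr_descCochain]

end

variable {a b c d comm} in
lemma sq_ext {L : Ch R} {n : ℤ} {z z' : Cochain (mappingCone (mappingCone.map b d a c comm)) L n}
    (n₁ n₂ : ℤ) (hn₁ : -1 + n = n₁) (hn₂ : -2 + n = n₂)
    (h₀₀ : (ι₀₀ a b c d comm).comp z hn₂ = (ι₀₀ a b c d comm).comp z' hn₂)
    (h₁₀ : (ι₁₀ a b c d comm).comp z hn₁ = (ι₁₀ a b c d comm).comp z' hn₁)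
    (h₀₁ : (ι₀₁ a b c d comm).comp z hn₁ = (ι₀₁ a b c d comm).comp z' hn₁)
    (h₁₁ : (ι₁₁ a b c d comm).comp z (zero_add n) =
      (ι₁₁ a b c d comm).comp z' (zero_add n)) : z = z' := by
  rw [ι₀₀, Cochain.comp_assoc _ _ _ _ hn₁ (by lia),
    Cochain.comp_assoc _ _ _ _ hn₁ (by lia)] at h₀₀
  rw [ι₁₀, Cochain.comp_assoc _ _ _ _ hn₁ (by lia),
    Cochain.comp_assoc _ _ _ _ hn₁ (by lia)] at h₁₀
  rw [ι₀₁, Cochain.comp_assoc _ _ _ _ (zero_add n) (by lia),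
    Cochain.comp_assoc _ _ _ _ (zero_add n) (by lia)] at h₀₁
  rw [ι₁₁, Cochain.ofHom_comp, Cochain.comp_assoc _ _ _ _ (zero_add n) (by lia),
    Cochain.comp_assoc _ _ _ _ (zero_add n) (by lia)] at h₁₁
  refine (mappingCone.ext_cochain_from_iff _ n₁ n (by lia)).2
    ⟨(mappingCone.ext_cochain_from_iff _ n₂ n₁ (by lia)).2 ⟨h₀₀, h₁₀⟩,
      (mappingCone.ext_cochain_from_iff _ n₁ n (by lia)).2 ⟨h₀₁, h₁₁⟩⟩

end Square

section Naturality

variable {M₀₀ M₁₀ M₀₁ M₁₁ M'₀₀ M'₁₀ M'₀₁ M'₁₁ : Ch R}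
  {a : M₀₀ ⟶ M₀₁} {b : M₀₀ ⟶ M₁₀} {c : M₁₀ ⟶ M₁₁} {d : M₀₁ ⟶ M₁₁} (comm : b ≫ c = a ≫ d)
  {a' : M'₀₀ ⟶ M'₀₁} {b' : M'₀₀ ⟶ M'₁₀} {c' : M'₁₀ ⟶ M'₁₁} {d' : M'₀₁ ⟶ M'₁₁}
  (comm' : b' ≫ c' = a' ≫ d') (x₀₀ : M₀₀ ⟶ M'₀₀) (x₁₀ : M₁₀ ⟶ M'₁₀) (x₀₁ : M₀₁ ⟶ M'₀₁)
  (x₁₁ : M₁₁ ⟶ M'₁₁) (hb : b ≫ x₁₀ = x₀₀ ≫ b') (hd : d ≫ x₁₁ = x₀₁ ≫ d')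
  (h : mappingCone.map b d a c comm ≫ mappingCone.map d d' x₀₁ x₁₁ hd =
    mappingCone.map b b' x₀₀ x₁₀ hb ≫ mappingCone.map b' d' a' c' comm')

lemma ι₀₀_comp_map : (ι₀₀ a b c d comm).comp (Cochain.ofHom (mappingCone.map _ _ _ _ h))
    (add_zero _) = (Cochain.ofHom x₀₀).comp (ι₀₀ a' b' c' d' comm') (zero_add _) := by
  rw [ι₀₀, Cochain.comp_assoc _ _ _ _ (add_zero _) (by lia), inl_comp_ofHom_map,
    ← Cochain.comp_assoc _ _ _ (add_zero _) _ (by lia), inl_comp_ofHom_map, ι₀₀,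
    Cochain.comp_assoc_of_first_is_zero_cochain]

lemma ι₁₀_comp_map : (ι₁₀ a b c d comm).comp (Cochain.ofHom (mappingCone.map _ _ _ _ h))
    (add_zero _) = (Cochain.ofHom x₁₀).comp (ι₁₀ a' b' c' d' comm') (zero_add _) := by
  rw [ι₁₀, Cochain.comp_assoc _ _ _ _ (add_zero _) (by lia), inl_comp_ofHom_map,
    ← Cochain.comp_assoc _ _ _ (add_zero _) _ (by lia), ← Cochain.ofHom_comp, inr_comp_map, ι₁₀,
    Cochain.ofHom_comp, Cochain.comp_assoc_of_first_is_zero_cochain]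

lemma ι₀₁_comp_map : (ι₀₁ a b c d comm).comp (Cochain.ofHom (mappingCone.map _ _ _ _ h))
    (add_zero _) = (Cochain.ofHom x₀₁).comp (ι₀₁ a' b' c' d' comm') (zero_add _) := by
  rw [ι₀₁, Cochain.comp_assoc _ _ _ _ (add_zero _) (by lia), ← Cochain.ofHom_comp, inr_comp_map,
    Cochain.ofHom_comp, ← Cochain.comp_assoc _ _ _ (add_zero _) _ (by lia), inl_comp_ofHom_map,
    ι₀₁, Cochain.comp_assoc_of_first_is_zero_cochain]

lemma ι₁₁_comp_map : (ι₁₁ a b c d comm).comp (Cochain.ofHom (mappingCone.map _ _ _ _ h))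
    (add_zero _) = (Cochain.ofHom x₁₁).comp (ι₁₁ a' b' c' d' comm') (zero_add _) := by
  rw [ι₁₁, ι₁₁, ← Cochain.ofHom_comp, ← Cochain.ofHom_comp, Category.assoc, inr_comp_map,
    ← Category.assoc, inr_comp_map, Category.assoc]

end Naturality

lemma comp_inl_δ {K X Y : Ch R} {G : X ⟶ Y} {n m l : ℤ} (k : Cochain K X n) (h : n - 1 = m)
    (h' : n + 1 = l) :
    δ m n (k.comp (mappingCone.inl G) (by lia)) =
      (k.comp (Cochain.ofHom G) (add_zero _)).comp (Cochain.ofHom (mappingCone.inr G))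
        (add_zero _) - (δ n l k).comp (mappingCone.inl G) (by lia) := by
  rw [δ_comp _ _ _ l 0 n (by lia) (by lia) (by lia), mappingCone.δ_inl, Cochain.ofHom_comp,
    ← Cochain.comp_assoc_of_second_is_zero_cochain]
  simp [sub_eq_add_neg]

lemma comp_δ {K L M : Ch R} {n n' n'' : ℤ} (z : Cochain K L n) (w : Cochain L M (-1))
    (h' : n + -1 = n') (h'' : n + 1 = n'') :
    z.comp (δ (-1) 0 w) (add_zero n) =
      δ n' n (z.comp w h') + (δ n n'' z).comp w (by lia) := by
  rw [δ_comp z w h' n'' 0 n (by lia) (by lia) (by lia)]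
  simp

lemma ofHom_comp_ofHom_comp {K L M P : Ch R} {n : ℤ} (f : K ⟶ L) (g : L ⟶ M) (z : Cochain M P n) :
    (Cochain.ofHom f).comp ((Cochain.ofHom g).comp z (zero_add n)) (zero_add n) =
      (Cochain.ofHom (f ≫ g)).comp z (zero_add n) := by
  rw [Cochain.ofHom_comp, Cochain.comp_assoc_of_first_is_zero_cochain]

variable (R) in
/-- A commutative 3-cube of cochain complexes. -/
structure Cube : Type (v + 1) where
  {N₀₀₀ N₀₀₁ N₀₁₀ N₀₁₁ N₁₀₀ N₁₀₁ N₁₁₀ N₁₁₁ : Ch.{v} R}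
  ζ : N₀₀₀ ⟶ N₀₀₁
  η : N₀₀₀ ⟶ N₁₀₀
  ν : N₀₀₀ ⟶ N₀₁₀
  β : N₀₀₁ ⟶ N₁₀₁
  α : N₀₀₁ ⟶ N₀₁₁
  ε : N₁₀₀ ⟶ N₁₀₁
  μ : N₁₀₀ ⟶ N₁₁₀
  κ : N₀₁₀ ⟶ N₀₁₁
  lam : N₀₁₀ ⟶ N₁₁₀
  γ : N₁₀₁ ⟶ N₁₁₁
  δ : N₀₁₁ ⟶ N₁₁₁
  π : N₁₁₀ ⟶ N₁₁₁
  face₁ : η ≫ μ = ν ≫ lam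
  face₂ : β ≫ γ = α ≫ δ
  face₃ : η ≫ ε = ζ ≫ β
  face₄ : lam ≫ π = κ ≫ δ
  face₅ : ζ ≫ α = ν ≫ κ
  face₆ : ε ≫ γ = μ ≫ π

namespace Cube

variable (N : Cube.{v} R)

lemma map_comp_map : mappingCone.map N.η N.lam N.ν N.μ N.face₁ ≫
      mappingCone.map N.lam N.δ N.κ N.π N.face₄ =
    mappingCone.map N.η N.β N.ζ N.ε N.face₃ ≫ mappingCone.map N.β N.δ N.α N.γ N.face₂ := by
  rw [← mappingCone.map_comp, ← mappingCone.map_comp]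
  exact mappingConeMapCongr _ _ N.face₅.symm N.face₆.symm _ _

/-- The map between the total cofibers of the faces with constant third coordinate. -/
noncomputable abbrev faceMap :
    mappingCone (mappingCone.map N.η N.lam N.ν N.μ N.face₁) ⟶
      mappingCone (mappingCone.map N.β N.δ N.α N.γ N.face₂) :=
  mappingCone.map _ _ _ _ N.map_comp_map

/-- The total cofiber of a cube. -/
noncomputable abbrev cofiber : Ch R := mappingCone N.faceMap

/-- The inclusion of the vertex `N₀₀₀` in the total cofiber. -/
noncomputable def i₀₀₀ : Cochain N.N₀₀₀ N.cofiber (-3) :=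
  (ι₀₀ _ _ _ _ N.face₁).comp (mappingCone.inl N.faceMap) (by lia)

/-- The inclusion of the vertex `N₁₀₀` in the total cofiber. -/
noncomputable def i₁₀₀ : Cochain N.N₁₀₀ N.cofiber (-2) :=
  (ι₁₀ _ _ _ _ N.face₁).comp (mappingCone.inl N.faceMap) (by lia)

/-- The inclusion of the vertex `N₀₁₀` in the total cofiber. -/
noncomputable def i₀₁₀ : Cochain N.N₀₁₀ N.cofiber (-2) :=
  (ι₀₁ _ _ _ _ N.face₁).comp (mappingCone.inl N.faceMap) (by lia)

/-- The inclusion of the vertex `N₁₁₀` in the total cofiber. -/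
noncomputable def i₁₁₀ : Cochain N.N₁₁₀ N.cofiber (-1) :=
  (ι₁₁ _ _ _ _ N.face₁).comp (mappingCone.inl N.faceMap) (by lia)

/-- The inclusion of the vertex `N₀₀₁` in the total cofiber. -/
noncomputable def i₀₀₁ : Cochain N.N₀₀₁ N.cofiber (-2) :=
  (ι₀₀ _ _ _ _ N.face₂).comp (Cochain.ofHom (mappingCone.inr N.faceMap)) (by lia)

/-- The inclusion of the vertex `N₁₀₁` in the total cofiber. -/
noncomputable def i₁₀₁ : Cochain N.N₁₀₁ N.cofiber (-1) :=
  (ι₁₀ _ _ _ _ N.face₂).comp (Cochain.ofHom (mappingCone.inr N.faceMap)) (by lia)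

/-- The inclusion of the vertex `N₀₁₁` in the total cofiber. -/
noncomputable def i₀₁₁ : Cochain N.N₀₁₁ N.cofiber (-1) :=
  (ι₀₁ _ _ _ _ N.face₂).comp (Cochain.ofHom (mappingCone.inr N.faceMap)) (by lia)

/-- The inclusion of the vertex `N₁₁₁` in the total cofiber. -/
noncomputable def i₁₁₁ : Cochain N.N₁₁₁ N.cofiber 0 :=
  (ι₁₁ _ _ _ _ N.face₂).comp (Cochain.ofHom (mappingCone.inr N.faceMap)) (by lia)

lemma δ_i₀₀₀ : HomComplex.δ (-3) (-2) N.i₀₀₀ =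
    (Cochain.ofHom N.ζ).comp N.i₀₀₁ (zero_add _) - (Cochain.ofHom N.ν).comp N.i₀₁₀ (zero_add _) +
      (Cochain.ofHom N.η).comp N.i₁₀₀ (zero_add _) := by
  rw [i₀₀₀, comp_inl_δ _ (by lia) (show _ + 1 = (-1 : ℤ) by rfl), ι₀₀_comp_map, δ_ι₀₀,
    Cochain.sub_comp, Cochain.comp_assoc_of_first_is_zero_cochain,
    Cochain.comp_assoc_of_first_is_zero_cochain, Cochain.comp_assoc_of_first_is_zero_cochain,
    i₀₀₁, i₀₁₀, i₁₀₀]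
  abel

lemma δ_i₁₀₀ : HomComplex.δ (-2) (-1) N.i₁₀₀ =
    (Cochain.ofHom N.ε).comp N.i₁₀₁ (zero_add _) -
      (Cochain.ofHom N.μ).comp N.i₁₁₀ (zero_add _) := by
  rw [i₁₀₀, comp_inl_δ _ (by lia) (show _ + 1 = 0 by rfl), ι₁₀_comp_map, δ_ι₁₀,
    Cochain.comp_assoc_of_first_is_zero_cochain, Cochain.comp_assoc_of_first_is_zero_cochain,
    i₁₀₁, i₁₁₀]

lemma δ_i₀₁₀ : HomComplex.δ (-2) (-1) N.i₀₁₀ =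
    (Cochain.ofHom N.κ).comp N.i₀₁₁ (zero_add _) -
      (Cochain.ofHom N.lam).comp N.i₁₁₀ (zero_add _) := by
  rw [i₀₁₀, comp_inl_δ _ (by lia) (show _ + 1 = 0 by rfl), ι₀₁_comp_map, δ_ι₀₁,
    Cochain.comp_assoc_of_first_is_zero_cochain, Cochain.comp_assoc_of_first_is_zero_cochain,
    i₀₁₁, i₁₁₀]

lemma δ_i₁₁₀ : HomComplex.δ (-1) 0 N.i₁₁₀ = (Cochain.ofHom N.π).comp N.i₁₁₁ (zero_add _) := by
  rw [i₁₁₀, comp_inl_δ _ (by lia) (show _ + 1 = 1 by rfl), ι₁₁_comp_map, δ_ι₁₁,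
    Cochain.zero_comp, sub_zero, Cochain.comp_assoc_of_first_is_zero_cochain, i₁₁₁]

lemma δ_i₀₀₁ : HomComplex.δ (-2) (-1) N.i₀₀₁ =
    (Cochain.ofHom N.α).comp N.i₀₁₁ (zero_add _) -
      (Cochain.ofHom N.β).comp N.i₁₀₁ (zero_add _) := by
  rw [i₀₀₁, δ_comp_ofHom, δ_ι₀₀, Cochain.sub_comp, Cochain.comp_assoc_of_first_is_zero_cochain,
    Cochain.comp_assoc_of_first_is_zero_cochain, i₀₁₁, i₁₀₁]

lemma δ_i₁₀₁ : HomComplex.δ (-1) 0 N.i₁₀₁ = (Cochain.ofHom N.γ).comp N.i₁₁₁ (zero_add _) := by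
  rw [i₁₀₁, δ_comp_ofHom, δ_ι₁₀, Cochain.comp_assoc_of_first_is_zero_cochain, i₁₁₁]

lemma δ_i₀₁₁ : HomComplex.δ (-1) 0 N.i₀₁₁ = (Cochain.ofHom N.δ).comp N.i₁₁₁ (zero_add _) := by
  rw [i₀₁₁, δ_comp_ofHom, δ_ι₀₁, Cochain.comp_assoc_of_first_is_zero_cochain, i₁₁₁]

lemma δ_i₁₁₁ : HomComplex.δ 0 1 N.i₁₁₁ = 0 := by
  rw [i₁₁₁, δ_comp_ofHom, δ_ι₁₁, Cochain.zero_comp]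

section

variable {L : Ch R} {n₃ n₂ n₁ n : ℤ} (x₀₀₀ : Cochain N.N₀₀₀ L n₃)
    (x₁₀₀ : Cochain N.N₁₀₀ L n₂) (x₀₁₀ : Cochain N.N₀₁₀ L n₂) (x₁₁₀ : Cochain N.N₁₁₀ L n₁)
    (x₀₀₁ : Cochain N.N₀₀₁ L n₂) (x₁₀₁ : Cochain N.N₁₀₁ L n₁) (x₀₁₁ : Cochain N.N₀₁₁ L n₁)
    (x₁₁₁ : Cochain N.N₁₁₁ L n) (h₁ : n₃ + 1 = n₂) (h₂ : n₂ + 1 = n₁) (h₃ : n₁ + 1 = n)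

/-- The cochain from the total cofiber of a cube given by cochains from its vertices. -/
noncomputable def desc : Cochain N.cofiber L n :=
  mappingCone.descCochain _ (descSq _ _ _ _ N.face₁ x₀₀₀ x₁₀₀ x₀₁₀ x₁₁₀ h₁ h₂)
    (descSq _ _ _ _ N.face₂ x₀₀₁ x₁₀₁ x₀₁₁ x₁₁₁ h₂ h₃) h₃

@[simp]
lemma i₀₀₀_desc (h : -3 + n = n₃) : N.i₀₀₀.comp
    (N.desc x₀₀₀ x₁₀₀ x₀₁₀ x₁₁₀ x₀₀₁ x₁₀₁ x₀₁₁ x₁₁₁ h₁ h₂ h₃) h = x₀₀₀ := by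
  rw [i₀₀₀, desc, Cochain.comp_assoc _ _ _ _ (show -1 + n = n₁ by lia) (by lia),
    mappingCone.inl_descCochain, ι₀₀_descSq]

@[simp]
lemma i₁₀₀_desc (h : -2 + n = n₂) : N.i₁₀₀.comp
    (N.desc x₀₀₀ x₁₀₀ x₀₁₀ x₁₁₀ x₀₀₁ x₁₀₁ x₀₁₁ x₁₁₁ h₁ h₂ h₃) h = x₁₀₀ := by
  rw [i₁₀₀, desc, Cochain.comp_assoc _ _ _ _ (show -1 + n = n₁ by lia) (by lia),
    mappingCone.inl_descCochain, ι₁₀_descSq]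

@[simp]
lemma i₀₁₀_desc (h : -2 + n = n₂) : N.i₀₁₀.comp
    (N.desc x₀₀₀ x₁₀₀ x₀₁₀ x₁₁₀ x₀₀₁ x₁₀₁ x₀₁₁ x₁₁₁ h₁ h₂ h₃) h = x₀₁₀ := by
  rw [i₀₁₀, desc, Cochain.comp_assoc _ _ _ _ (show -1 + n = n₁ by lia) (by lia),
    mappingCone.inl_descCochain, ι₀₁_descSq]

@[simp]
lemma i₁₁₀_desc (h : -1 + n = n₁) : N.i₁₁₀.comp
    (N.desc x₀₀₀ x₁₀₀ x₀₁₀ x₁₁₀ x₀₀₁ x₁₀₁ x₀₁₁ x₁₁₁ h₁ h₂ h₃) h = x₁₁₀ := by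
  rw [i₁₁₀, desc, Cochain.comp_assoc _ _ _ _ h (by lia),
    mappingCone.inl_descCochain, ι₁₁_descSq]

@[simp]
lemma i₀₀₁_desc (h : -2 + n = n₂) : N.i₀₀₁.comp
    (N.desc x₀₀₀ x₁₀₀ x₀₁₀ x₁₁₀ x₀₀₁ x₁₀₁ x₀₁₁ x₁₁₁ h₁ h₂ h₃) h = x₀₀₁ := by
  rw [i₀₀₁, desc, Cochain.comp_assoc _ _ _ _ (zero_add n) (by lia),
    mappingCone.inr_descCochain, ι₀₀_descSq]

@[simp]
lemma i₁₀₁_desc (h : -1 + n = n₁) : N.i₁₀₁.comp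
    (N.desc x₀₀₀ x₁₀₀ x₀₁₀ x₁₁₀ x₀₀₁ x₁₀₁ x₀₁₁ x₁₁₁ h₁ h₂ h₃) h = x₁₀₁ := by
  rw [i₁₀₁, desc, Cochain.comp_assoc _ _ _ _ (zero_add n) (by lia),
    mappingCone.inr_descCochain, ι₁₀_descSq]

@[simp]
lemma i₀₁₁_desc (h : -1 + n = n₁) : N.i₀₁₁.comp
    (N.desc x₀₀₀ x₁₀₀ x₀₁₀ x₁₁₀ x₀₀₁ x₁₀₁ x₀₁₁ x₁₁₁ h₁ h₂ h₃) h = x₀₁₁ := by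
  rw [i₀₁₁, desc, Cochain.comp_assoc _ _ _ _ (zero_add n) (by lia),
    mappingCone.inr_descCochain, ι₀₁_descSq]

@[simp]
lemma i₁₁₁_desc : N.i₁₁₁.comp
    (N.desc x₀₀₀ x₁₀₀ x₀₁₀ x₁₁₀ x₀₀₁ x₁₀₁ x₀₁₁ x₁₁₁ h₁ h₂ h₃) (zero_add n) = x₁₁₁ := by
  rw [i₁₁₁, desc, Cochain.comp_assoc _ _ _ _ (zero_add n) (by lia),
    mappingCone.inr_descCochain, ι₁₁_descSq]

end

variable {N} in
lemma ext_cochain {L : Ch R} {n : ℤ} {z z' : Cochain N.cofiber L n} (n₁ n₂ n₃ : ℤ)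
    (hn₁ : -1 + n = n₁) (hn₂ : -2 + n = n₂) (hn₃ : -3 + n = n₃)
    (h₀₀₀ : N.i₀₀₀.comp z hn₃ = N.i₀₀₀.comp z' hn₃)
    (h₁₀₀ : N.i₁₀₀.comp z hn₂ = N.i₁₀₀.comp z' hn₂)
    (h₀₁₀ : N.i₀₁₀.comp z hn₂ = N.i₀₁₀.comp z' hn₂)
    (h₁₁₀ : N.i₁₁₀.comp z hn₁ = N.i₁₁₀.comp z' hn₁)
    (h₀₀₁ : N.i₀₀₁.comp z hn₂ = N.i₀₀₁.comp z' hn₂)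
    (h₁₀₁ : N.i₁₀₁.comp z hn₁ = N.i₁₀₁.comp z' hn₁)
    (h₀₁₁ : N.i₀₁₁.comp z hn₁ = N.i₀₁₁.comp z' hn₁)
    (h₁₁₁ : N.i₁₁₁.comp z (zero_add n) = N.i₁₁₁.comp z' (zero_add n)) : z = z' := by
  rw [i₀₀₀, Cochain.comp_assoc _ _ _ _ hn₁ (by lia),
    Cochain.comp_assoc _ _ _ _ hn₁ (by lia)] at h₀₀₀
  rw [i₁₀₀, Cochain.comp_assoc _ _ _ _ hn₁ (by lia),
    Cochain.comp_assoc _ _ _ _ hn₁ (by lia)] at h₁₀₀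
  rw [i₀₁₀, Cochain.comp_assoc _ _ _ _ hn₁ (by lia),
    Cochain.comp_assoc _ _ _ _ hn₁ (by lia)] at h₀₁₀
  rw [i₁₁₀, Cochain.comp_assoc _ _ _ _ hn₁ (by lia),
    Cochain.comp_assoc _ _ _ _ hn₁ (by lia)] at h₁₁₀
  rw [i₀₀₁, Cochain.comp_assoc_of_second_is_zero_cochain,
    Cochain.comp_assoc_of_second_is_zero_cochain] at h₀₀₁
  rw [i₁₀₁, Cochain.comp_assoc_of_second_is_zero_cochain,
    Cochain.comp_assoc_of_second_is_zero_cochain] at h₁₀₁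
  rw [i₀₁₁, Cochain.comp_assoc_of_second_is_zero_cochain,
    Cochain.comp_assoc_of_second_is_zero_cochain] at h₀₁₁
  rw [i₁₁₁, Cochain.comp_assoc_of_second_is_zero_cochain,
    Cochain.comp_assoc_of_second_is_zero_cochain] at h₁₁₁
  exact (mappingCone.ext_cochain_from_iff _ n₁ n (by lia)).2
    ⟨sq_ext n₂ n₃ (by lia) (by lia) h₀₀₀ h₁₀₀ h₀₁₀ h₁₁₀,
      sq_ext n₁ n₂ (by lia) (by lia) h₀₀₁ h₁₀₁ h₀₁₁ h₁₁₁⟩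

lemma exists_quasiIso (r : N.N₁₀₁ ⟶ N.N₀₀₁) (s : N.N₁₁₁ ⟶ N.N₁₀₁) (t : N.N₁₀₀ ⟶ N.N₀₀₁)
    (hβr : N.β ≫ r = 𝟙 _) (hsγ : s ≫ N.γ = 𝟙 _) (hsr : s ≫ r = 0)
    (hrs : r ≫ N.β + N.γ ≫ s - r ≫ N.β ≫ N.γ ≫ s = 𝟙 _) (htβ : t ≫ N.β = N.ε)
    (htη : N.η ≫ t = N.ζ)
    (comm : N.η ≫ biprod.lift N.μ (t ≫ N.α) = N.ν ≫ biprod.lift N.lam N.κ) :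
    ∃ φ : (mappingCone (mappingCone.map N.η (biprod.lift N.lam N.κ) N.ν
      (biprod.lift N.μ (t ≫ N.α)) comm))⟦(1 : ℤ)⟧ ⟶ N.cofiber, QuasiIso φ := by
  have hεr : N.ε ≫ r = t := by rw [← htβ, Category.assoc, hβr, Category.comp_id]
  have hμπ : N.μ ≫ N.π ≫ s = t ≫ N.α ≫ N.δ ≫ s := by
    rw [← reassoc_of% N.face₆, ← htβ, Category.assoc, reassoc_of% N.face₂]
  let j₀₀ := ι₀₀ _ _ _ _ comm
  let j₁₀ := ι₁₀ _ _ _ _ comm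
  let j₀₁ := ι₀₁ _ _ _ _ comm
  let j₁₁ := ι₁₁ _ _ _ _ comm
  let F := descSq (n₂ := -3) (n₁ := -2) (n := -1) _ _ _ _ comm N.i₀₀₀
    (N.i₁₀₀ + (Cochain.ofHom t).comp N.i₀₀₁ (zero_add _)) N.i₀₁₀
    ((Cochain.ofHom biprod.fst).comp
        (N.i₁₁₀ - (Cochain.ofHom (N.π ≫ s)).comp N.i₁₀₁ (zero_add _)) (zero_add _) +
      (Cochain.ofHom biprod.snd).comp
        ((Cochain.ofHom (N.δ ≫ s)).comp N.i₁₀₁ (zero_add _) - N.i₀₁₁) (zero_add _))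
    (by lia) (by lia)
  let p := N.desc (n₃ := -2) (n₂ := -1) (n₁ := 0) (n := 1) j₀₀ j₁₀ j₀₁
    ((Cochain.ofHom biprod.inl).comp j₁₁ (zero_add _)) 0
    (-(Cochain.ofHom (r ≫ N.α ≫ biprod.inr)).comp j₁₁ (zero_add _))
    (-(Cochain.ofHom biprod.inr).comp j₁₁ (zero_add _)) 0 (by lia) (by lia) (by lia)
  let h := N.desc (L := N.cofiber) (n₃ := -4) (n₂ := -3) (n₁ := -2) (n := -1) 0 0 0 0 0
    (-(Cochain.ofHom r).comp N.i₀₀₁ (zero_add _)) 0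
    ((Cochain.ofHom s).comp N.i₁₀₁ (zero_add _)) (by lia) (by lia) (by lia)
  refine exists_quasiIso_shift F ?_ p h ?_ ?_
  · refine sq_ext (-1) (-2) rfl rfl ?_ ?_ ?_ ?_
    · rw [comp_δ _ _ (show (-2 : ℤ) + -1 = -3 by rfl) (show (-2 : ℤ) + 1 = -1 by rfl), δ_ι₀₀]
      simp [-Cochain.ofHom_comp, F, δ_i₀₀₀, ofHom_comp_ofHom_comp,
        Cochain.comp_assoc_of_first_is_zero_cochain]
      rw [htη]
      abel
    · rw [comp_δ _ _ (show (-1 : ℤ) + -1 = -2 by rfl) (show (-1 : ℤ) + 1 = 0 by rfl), δ_ι₁₀]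
      simp [-Cochain.ofHom_comp, F, δ_i₁₀₀, δ_i₀₀₁, ofHom_comp_ofHom_comp,
        Cochain.comp_assoc_of_first_is_zero_cochain]
      rw [htβ, hμπ]
      abel
    · rw [comp_δ _ _ (show (-1 : ℤ) + -1 = -2 by rfl) (show (-1 : ℤ) + 1 = 0 by rfl), δ_ι₀₁]
      simp [-Cochain.ofHom_comp, F, δ_i₀₁₀, ofHom_comp_ofHom_comp,
        Cochain.comp_assoc_of_first_is_zero_cochain]
      rw [reassoc_of% N.face₄]
      abel
    · rw [comp_δ _ _ (show (0 : ℤ) + -1 = -1 by rfl) (show (0 : ℤ) + 1 = 1 by rfl), δ_ι₁₁]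
      simp [-Cochain.ofHom_comp, F, δ_i₁₁₀, δ_i₁₀₁, δ_i₀₁₁, ofHom_comp_ofHom_comp]
      simp [-Cochain.ofHom_comp, hsγ]
  · refine sq_ext (-1) (-2) rfl rfl ?_ ?_ ?_ ?_
    · rw [← Cochain.comp_assoc _ _ _ (show (-2 : ℤ) + -1 = -3 by rfl) _ (by lia)]
      simp [-Cochain.ofHom_comp, F, p, j₀₀, ofHom_comp_ofHom_comp]
    · rw [← Cochain.comp_assoc _ _ _ (show (-1 : ℤ) + -1 = -2 by rfl) _ (by lia)]
      simp [-Cochain.ofHom_comp, F, p, j₁₀, ofHom_comp_ofHom_comp,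
        Cochain.comp_assoc_of_first_is_zero_cochain]
    · rw [← Cochain.comp_assoc _ _ _ (show (-1 : ℤ) + -1 = -2 by rfl) _ (by lia)]
      simp [-Cochain.ofHom_comp, F, p, j₀₁, ofHom_comp_ofHom_comp]
    · rw [← Cochain.comp_assoc _ _ _ (show (0 : ℤ) + -1 = -1 by rfl) _ (by lia)]
      simp [-Cochain.ofHom_comp, F, p, ofHom_comp_ofHom_comp,
        Cochain.comp_assoc_of_first_is_zero_cochain]
      simp [-Cochain.ofHom_comp, reassoc_of% hsr, ← Cochain.add_comp, ← Cochain.ofHom_add,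
        biprod.total, j₁₁]
  · refine ext_cochain (-1) (-2) (-3) rfl rfl rfl ?_ ?_ ?_ ?_ ?_ ?_ ?_ ?_
    · rw [Cochain.comp_add, ← Cochain.comp_assoc _ _ _ (show (-3 : ℤ) + 1 = -2 by rfl) _ (by lia),
        comp_δ _ _ (show (-3 : ℤ) + -1 = -4 by rfl) (show (-3 : ℤ) + 1 = -2 by rfl)]
      simp [-Cochain.ofHom_comp, F, p, h, j₀₀, δ_i₀₀₀, ofHom_comp_ofHom_comp,
        Cochain.comp_assoc_of_first_is_zero_cochain]
    · rw [Cochain.comp_add, ← Cochain.comp_assoc _ _ _ (show (-2 : ℤ) + 1 = -1 by rfl) _ (by lia),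
        comp_δ _ _ (show (-2 : ℤ) + -1 = -3 by rfl) (show (-2 : ℤ) + 1 = -1 by rfl)]
      simp [-Cochain.ofHom_comp, F, p, h, j₁₀, δ_i₁₀₀, ofHom_comp_ofHom_comp,
        Cochain.comp_assoc_of_first_is_zero_cochain]
      rw [hεr]
      abel
    · rw [Cochain.comp_add, ← Cochain.comp_assoc _ _ _ (show (-2 : ℤ) + 1 = -1 by rfl) _ (by lia),
        comp_δ _ _ (show (-2 : ℤ) + -1 = -3 by rfl) (show (-2 : ℤ) + 1 = -1 by rfl)]
      simp [-Cochain.ofHom_comp, F, p, h, j₀₁, δ_i₀₁₀, ofHom_comp_ofHom_comp,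
        Cochain.comp_assoc_of_first_is_zero_cochain]
    · rw [Cochain.comp_add, ← Cochain.comp_assoc _ _ _ (show (-1 : ℤ) + 1 = 0 by rfl) _ (by lia),
        comp_δ _ _ (show (-1 : ℤ) + -1 = -2 by rfl) (show (-1 : ℤ) + 1 = 0 by rfl)]
      simp [-Cochain.ofHom_comp, F, p, h, j₁₁, δ_i₁₁₀, ofHom_comp_ofHom_comp,
        Cochain.comp_assoc_of_first_is_zero_cochain]
    · rw [Cochain.comp_add, ← Cochain.comp_assoc _ _ _ (show (-2 : ℤ) + 1 = -1 by rfl) _ (by lia),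
        comp_δ _ _ (show (-2 : ℤ) + -1 = -3 by rfl) (show (-2 : ℤ) + 1 = -1 by rfl)]
      simp [-Cochain.ofHom_comp, F, p, h, δ_i₀₀₁, ofHom_comp_ofHom_comp,
        Cochain.comp_assoc_of_first_is_zero_cochain]
      simp [-Cochain.ofHom_comp, hβr]
    · rw [Cochain.comp_add, ← Cochain.comp_assoc _ _ _ (show (-1 : ℤ) + 1 = 0 by rfl) _ (by lia),
        comp_δ _ _ (show (-1 : ℤ) + -1 = -2 by rfl) (show (-1 : ℤ) + 1 = 0 by rfl)]
      simp [-Cochain.ofHom_comp, F, p, h, j₁₁, δ_i₀₀₁, δ_i₁₀₁, ofHom_comp_ofHom_comp,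
        Cochain.comp_assoc_of_first_is_zero_cochain]
      have hi := congrArg (fun f ↦ (Cochain.ofHom f).comp N.i₁₀₁ (zero_add _)) hrs
      simp only [Cochain.ofHom_add, Cochain.ofHom_sub, Cochain.add_comp, Cochain.sub_comp,
        Cochain.id_comp, reassoc_of% N.face₂] at hi
      refine Eq.trans ?_ hi
      abel
    · rw [Cochain.comp_add, ← Cochain.comp_assoc _ _ _ (show (-1 : ℤ) + 1 = 0 by rfl) _ (by lia),
        comp_δ _ _ (show (-1 : ℤ) + -1 = -2 by rfl) (show (-1 : ℤ) + 1 = 0 by rfl)]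
      simp [-Cochain.ofHom_comp, F, p, h, j₁₁, δ_i₀₁₁, ofHom_comp_ofHom_comp,
        Cochain.comp_assoc_of_first_is_zero_cochain]
    · rw [Cochain.comp_add, ← Cochain.comp_assoc _ _ _ (show (0 : ℤ) + 1 = 1 by rfl) _ (by lia),
        comp_δ _ _ (show (0 : ℤ) + -1 = -1 by rfl) (show (0 : ℤ) + 1 = 1 by rfl)]
      simp [-Cochain.ofHom_comp, F, p, h, δ_i₁₀₁, δ_i₁₁₁, ofHom_comp_ofHom_comp]
      simp [-Cochain.ofHom_comp, hsγ]

/-- The cube obtained from `N` by replacing `N₁₀₁` with `N₀₀₁ ⊞ N₁₁₁`. -/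
noncomputable abbrev split (t : N.N₁₀₀ ⟶ N.N₀₀₁) (htβ : t ≫ N.β = N.ε) (htη : N.η ≫ t = N.ζ) :
    Cube.{v} R where
  N₁₀₁ := N.N₀₀₁ ⊞ N.N₁₁₁
  ζ := N.ζ
  η := N.η
  ν := N.ν
  β := biprod.inl
  α := N.α
  ε := t ≫ biprod.inl
  μ := N.μ
  κ := N.κ
  lam := N.lam
  γ := biprod.desc (N.β ≫ N.γ) (𝟙 _)
  δ := N.δ
  π := N.π
  face₁ := N.face₁
  face₂ := by rw [biprod.inl_desc, N.face₂]
  face₃ := by rw [← Category.assoc, htη]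
  face₄ := N.face₄
  face₅ := N.face₅
  face₆ := by rw [Category.assoc, biprod.inl_desc, ← Category.assoc, htβ, N.face₆]

lemma exists_quasiIso_split (s : N.N₁₁₁ ⟶ N.N₁₀₁) (hsγ : s ≫ N.γ = 𝟙 _)
    (hqi : QuasiIso (biprod.desc N.β s)) (t : N.N₁₀₀ ⟶ N.N₀₀₁) (htβ : t ≫ N.β = N.ε)
    (htη : N.η ≫ t = N.ζ) :
    ∃ φ : (N.split t htβ htη).cofiber ⟶ N.cofiber, QuasiIso φ := by
  let N' := N.split t htβ htη
  let q : N'.N₁₀₁ ⟶ N.N₁₀₁ := biprod.desc N.β s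
  have hβ : N'.β ≫ q = 𝟙 _ ≫ N.β := by simp [N', q]
  have hγ : N'.γ ≫ 𝟙 _ = q ≫ N.γ := by apply biprod.hom_ext' <;> simp [N', q, hsγ]
  have hδ : N.δ ≫ 𝟙 _ = 𝟙 _ ≫ N.δ := by simp
  have hβδ : mappingCone.map N'.β N'.δ N'.α N'.γ N'.face₂ ≫
      mappingCone.map N'.δ N.δ (𝟙 _) (𝟙 _) hδ =
        mappingCone.map N'.β N.β (𝟙 _) q hβ ≫ mappingCone.map N.β N.δ N.α N.γ N.face₂ := by
    rw [← mappingCone.map_comp, ← mappingCone.map_comp]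
    exact mappingConeMapCongr _ _ (by simp [N']) hγ _ _
  have hface : N'.faceMap ≫ mappingCone.map _ _ _ _ hβδ = 𝟙 _ ≫ N.faceMap := by
    rw [Category.id_comp, ← mappingCone.map_comp]
    refine mappingConeMapCongr _ _ ?_ ?_ _ _
    · rw [← mappingCone.map_comp]
      exact mappingConeMapCongr _ _ (by simp [N']) (by simp [N', q, htβ]) _ _
    · rw [← mappingCone.map_comp]
      exact mappingConeMapCongr _ _ (by simp [N']) (by simp [N']) _ _
  exact ⟨mappingCone.map _ _ _ _ hface,
    quasiIso_mappingCone_map _ _ _ _ _ inferInstance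
      (quasiIso_mappingCone_map _ _ _ _ _
        (quasiIso_mappingCone_map _ _ _ _ _ inferInstance hqi)
        (quasiIso_mappingCone_map _ _ _ _ _ inferInstance inferInstance))⟩

end Cube

end TotalCofiber

/-- let `N` be a commutative 3-cube of cochain complexes of `R`-modules as
above.  Assume (1) there is a chain map `s : N₁₁₁ → N₁₀₁` with `γ ∘ s = id` such that
`β ⊕ s : N₀₀₁ ⊕ N₁₁₁ → N₁₀₁` is a quasi-isomorphism, and (2) there is a chain map
`t : N₁₀₀ → N₀₀₁` with `β ∘ t = ε` and `t ∘ η = ζ`.  Then `C₃N` is quasi-isomorphic to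
`(C₂M)⟦1⟧`, where `M` is the commutative square with corners `N₀₀₀`, `N₁₀₀`, `N₀₁₀`,
`N₁₁₀ ⊕ N₀₁₁`, left map `η`, bottom map `ν`, top map `(μ, α∘t)` and right map `(λ, κ)`. -/
theorem stmt_2 {R : Type} [CommRing R]
    {N₀₀₀ N₀₀₁ N₀₁₀ N₀₁₁ N₁₀₀ N₁₀₁ N₁₁₀ N₁₁₁ : Ch R}
    (ζ : N₀₀₀ ⟶ N₀₀₁) (η : N₀₀₀ ⟶ N₁₀₀) (ν : N₀₀₀ ⟶ N₀₁₀)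
    (β : N₀₀₁ ⟶ N₁₀₁) (α : N₀₀₁ ⟶ N₀₁₁) (ε : N₁₀₀ ⟶ N₁₀₁) (μ : N₁₀₀ ⟶ N₁₁₀)
    (κ : N₀₁₀ ⟶ N₀₁₁) (lam : N₀₁₀ ⟶ N₁₁₀)
    (γ : N₁₀₁ ⟶ N₁₁₁) (δ : N₀₁₁ ⟶ N₁₁₁) (π : N₁₁₀ ⟶ N₁₁₁)
    (face₁ : η ≫ μ = ν ≫ lam) (face₂ : β ≫ γ = α ≫ δ)
    (face₃ : η ≫ ε = ζ ≫ β) (face₄ : lam ≫ π = κ ≫ δ)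
    (face₅ : ζ ≫ α = ν ≫ κ) (face₆ : ε ≫ γ = μ ≫ π)
    (s : N₁₁₁ ⟶ N₁₀₁) (hsγ : s ≫ γ = 𝟙 N₁₁₁)
    (hqi : QuasiIso (biprod.desc β s : N₀₀₁ ⊞ N₁₁₁ ⟶ N₁₀₁))
    (t : N₁₀₀ ⟶ N₀₀₁) (htβ : t ≫ β = ε) (htη : η ≫ t = ζ) :
    ∃ (Z : Ch R)
      (φ : Z ⟶ totalCofiberCube ζ η ν β α ε μ κ lam γ δ π
        face₁ face₂ face₃ face₄ face₅ face₆)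
      (ψ : Z ⟶ (totalCofiberSq ν η (biprod.lift μ (t ≫ α) : N₁₀₀ ⟶ N₁₁₀ ⊞ N₀₁₁)
          (biprod.lift lam κ : N₀₁₀ ⟶ N₁₁₀ ⊞ N₀₁₁)
          (by
            apply biprod.hom_ext
            · simp only [Category.assoc, biprod.lift_fst]
              exact face₁
            · simp only [Category.assoc, biprod.lift_snd]
              rw [← Category.assoc, htη, face₅]))⟦(1 : ℤ)⟧),
      QuasiIso φ ∧ QuasiIso ψ := by
  let N : TotalCofiber.Cube R := ⟨ζ, η, ν, β, α, ε, μ, κ, lam, γ, δ, π,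
    face₁, face₂, face₃, face₄, face₅, face₆⟩
  obtain ⟨φ, hφ⟩ := N.exists_quasiIso_split s hsγ hqi t htβ htη
  obtain ⟨ψ, hψ⟩ := (N.split t htβ htη).exists_quasiIso biprod.fst biprod.inr t
    (by simp) (by simp) (by simp) (by apply biprod.hom_ext' <;> simp) rfl htη
    (by apply biprod.hom_ext <;> simp [N, face₁, face₅, reassoc_of% htη])
  refine ⟨_, ?_, 𝟙 _, ?_, inferInstance⟩
  · exact ψ ≫ φ
  · exact quasiIso_comp ψ φ
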